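/- Let d ≥ 1, α > 0, let μ be a probability measure on ℝᵈ with finite first moment, and let ρ be the minimizer of F_μ over probability measures with finite first moment, written as ρ = (1/Z)·exp(−u − (α/2)‖·‖²)·Lebesgue with u : ℝᵈ → ℝ ∪ {+∞} convex lower-semicontinuous satisfying T(ρ,μ) = ∫ u dρ + ∫ u* dμ. Set Ω := {x ∈ ℝᵈ : u(x) < +∞}. Then u = +∞ at H^{d−1}-almost every point of the topological boundary ∂Ω, i.e. the (d−1)-dimensional Hausdorff measure of {x ∈ ∂Ω : u(x) < +∞} is zero; in particular u is essentially continuous. -/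

import Mathlib

open MeasureTheory ENNReal
open scoped RealInnerProductSpace

noncomputable section

/-- Euclidean space `ℝᵈ`. -/
abbrev Ed (d : ℕ) := EuclideanSpace ℝ (Fin d)

/-- The positive part of an extended real number, as an element of `ℝ≥0∞`. -/
noncomputable def EReal.posPart (a : EReal) : ℝ≥0∞ :=
  if a = ⊤ then ⊤ else ENNReal.ofReal a.toReal

/-- Signed integral (with values in `EReal`) of a real-valued function. -/
noncomputable def sInt {α : Type*} [MeasurableSpace α] (ν : Measure α) (g : α → ℝ) : EReal :=
  ((∫⁻ x, ENNReal.ofReal (g x) ∂ν : ℝ≥0∞) : EReal) -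
    ((∫⁻ x, ENNReal.ofReal (-(g x)) ∂ν : ℝ≥0∞) : EReal)

/-- Signed integral (with values in `EReal`) of an `EReal`-valued function. -/
noncomputable def eInt {α : Type*} [MeasurableSpace α] (ν : Measure α) (f : α → EReal) : EReal :=
  ((∫⁻ x, (f x).posPart ∂ν : ℝ≥0∞) : EReal) - ((∫⁻ x, (-(f x)).posPart ∂ν : ℝ≥0∞) : EReal)

/-- The set of couplings (transport plans) between two measures on `ℝᵈ`. -/
def couplings {d : ℕ} (ρ μ : Measure (Ed d)) : Set (Measure (Ed d × Ed d)) :=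
  {γ | IsProbabilityMeasure γ ∧ γ.map Prod.fst = ρ ∧ γ.map Prod.snd = μ}

/-- The maximal correlation functional `T(ρ, μ)`. -/
noncomputable def maxCorr {d : ℕ} (ρ μ : Measure (Ed d)) : EReal :=
  ⨆ γ ∈ couplings ρ μ, sInt γ (fun p => ⟪p.1, p.2⟫)

/-- The entropy `E(ρ)` of a measure with respect to Lebesgue measure. -/
noncomputable def Ent {d : ℕ} (ρ : Measure (Ed d)) : EReal := by
  classical
  exact if _h : ρ ≪ (volume : Measure (Ed d)) then
    sInt (volume : Measure (Ed d))
      (fun x => (ρ.rnDeriv volume x).toReal * Real.log (ρ.rnDeriv volume x).toReal)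
  else ⊤

/-- The second moment of a measure, with values in `ℝ≥0∞`. -/
noncomputable def M2e {d : ℕ} (ρ : Measure (Ed d)) : ℝ≥0∞ :=
  ∫⁻ x, ENNReal.ofReal (‖x‖ ^ 2) ∂ρ

/-- The regularized functional `F_μ(ρ) = E(ρ) + T(ρ, μ) + (α/2) M₂(ρ)`. -/
noncomputable def Ffun {d : ℕ} (α : ℝ) (μ ρ : Measure (Ed d)) : EReal :=
  Ent ρ + maxCorr ρ μ + ((α / 2 : ℝ) : EReal) * ((M2e ρ : ℝ≥0∞) : EReal)

/-- The `p`-th moment `M_p(ρ) = ∫ ‖x‖^p dρ`. -/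
noncomputable def Mp {d : ℕ} (p : ℝ) (ρ : Measure (Ed d)) : ℝ :=
  ∫ x, ‖x‖ ^ p ∂ρ

/-- The barycenter `b(ρ) = ∫ x dρ`. -/
noncomputable def bary {d : ℕ} (ρ : Measure (Ed d)) : Ed d :=
  ∫ x, x ∂ρ

/-- Probability measures on `ℝᵈ` with finite first moment. -/
def P1 (d : ℕ) : Set (Measure (Ed d)) :=
  {ρ | IsProbabilityMeasure ρ ∧ Integrable (fun x => ‖x‖) ρ}

/-- Probability measures on `ℝᵈ` with finite second moment. -/
def P2 (d : ℕ) : Set (Measure (Ed d)) :=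
  {ρ | IsProbabilityMeasure ρ ∧ Integrable (fun x => ‖x‖ ^ 2) ρ}

/-- `ρ` is a minimizer of `F_μ` over probability measures with finite first moment. -/
def IsMinOfF {d : ℕ} (α : ℝ) (μ ρ : Measure (Ed d)) : Prop :=
  ρ ∈ P1 d ∧ ∀ σ ∈ P1 d, Ffun α μ ρ ≤ Ffun α μ σ

/-- The 2-Wasserstein distance between two measures on `ℝᵈ`. -/
noncomputable def W2 {d : ℕ} (ρ μ : Measure (Ed d)) : ℝ :=
  Real.sqrt ((⨅ γ ∈ couplings ρ μ, ∫⁻ p, ENNReal.ofReal (‖p.1 - p.2‖ ^ 2) ∂γ).toReal)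

/-- Convexity of an `EReal`-valued function on `ℝᵈ`. -/
def EConvexOn {d : ℕ} (u : Ed d → EReal) : Prop :=
  ∀ x y : Ed d, ∀ s t : ℝ, 0 ≤ s → 0 ≤ t → s + t = 1 →
    u (s • x + t • y) ≤ (s : EReal) * u x + (t : EReal) * u y

/-- The Legendre transform `u*(y) = sup_x (⟨x, y⟩ - u(x))` of an `EReal`-valued function. -/
noncomputable def legendre {d : ℕ} (u : Ed d → EReal) : Ed d → EReal :=
  fun y => ⨆ x : Ed d, (((⟪x, y⟫ : ℝ) : EReal) - u x)

/-- The Gaussian-regularized density `exp(-u(x) - (α/2)‖x‖²)`, with value `0` where `u = ⊤`. -/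
noncomputable def gdens {d : ℕ} (α : ℝ) (u : Ed d → EReal) (x : Ed d) : ℝ≥0∞ :=
  if u x = ⊤ then 0 else ENNReal.ofReal (Real.exp (-(u x).toReal - (α / 2) * ‖x‖ ^ 2))

/-- A convex `EReal`-valued function is essentially continuous if it is continuous at
`H^{d-1}`-almost every point of the boundary of its finiteness domain. -/
def EssentiallyContinuous {d : ℕ} (u : Ed d → EReal) : Prop :=
  μH[(d : ℝ) - 1] {x ∈ frontier {y : Ed d | u y < ⊤} | ¬ ContinuousAt u x} = 0


open Filter Topology

/-- The union, over the points `a` of `A`, of the balls obtained by contracting `ball x₀ r`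
towards `a` with ratio `s`. -/
def coneNbhd {d : ℕ} (A : Set (Ed d)) (x₀ : Ed d) (r s : ℝ) : Set (Ed d) :=
  ⋃ a ∈ A, Metric.ball (a + s • (x₀ - a)) (s * r)

lemma isOpen_coneNbhd {d : ℕ} (A : Set (Ed d)) (x₀ : Ed d) (r s : ℝ) :
    IsOpen (coneNbhd A x₀ r s) :=
  isOpen_biUnion fun _ _ => Metric.isOpen_ball

lemma dist_lt_of_mem_contracted_ball {d : ℕ} {a x₀ x : Ed d} {r s D : ℝ} (hs : 0 < s)
    (hD : ‖x₀ - a‖ + r ≤ D) (hx : x ∈ Metric.ball (a + s • (x₀ - a)) (s * r)) :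
    ‖x - a‖ < s * D := by
  rw [mem_ball_iff_norm] at hx
  calc ‖x - a‖ = ‖(x - (a + s • (x₀ - a))) + s • (x₀ - a)‖ := by congr 1; abel
    _ ≤ ‖x - (a + s • (x₀ - a))‖ + ‖s • (x₀ - a)‖ := norm_add_le _ _
    _ = ‖x - (a + s • (x₀ - a))‖ + s * ‖x₀ - a‖ := by
        rw [norm_smul, Real.norm_of_nonneg hs.le]
    _ < s * r + s * ‖x₀ - a‖ := by gcongr
    _ ≤ s * D := by nlinarith

lemma ediam_closedBall_five_le {d : ℕ} (a : Ed d) (t : ℝ) :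
    Metric.ediam (Metric.closedBall a (5 * t)) ≤ ENNReal.ofReal (10 * t) := by
  refine Metric.ediam_le_of_forall_dist_le fun x hx y hy => ?_
  linarith [dist_triangle_right x y a, Metric.mem_closedBall.1 hx, Metric.mem_closedBall.1 hy]

/-- Every set admits, at each small scale `s`, a countable cover whose `(d-1)`-dimensional size is
controlled by `volume (coneNbhd A x₀ r s) / s`. -/
lemma exists_cover_of_coneNbhd {d : ℕ} (hd : 1 ≤ d) (A : Set (Ed d)) (x₀ : Ed d) {r D : ℝ}
    (hr : 0 < r) (hD : ∀ a ∈ A, ‖x₀ - a‖ + r ≤ D) (hD0 : 0 < D) :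
    ∃ k : ℝ, 0 < k ∧ ∀ s : ℝ, 0 < s → ∃ u : Set (Ed d), u.Countable ∧
      (A ⊆ ⋃ i : u, Metric.closedBall (i : Ed d) (5 * (s * D))) ∧
      (∑' i : u, Metric.ediam (Metric.closedBall (i : Ed d) (5 * (s * D))) ^ ((d : ℝ) - 1))
        * ENNReal.ofReal s ≤ ENNReal.ofReal k * volume (coneNbhd A x₀ r s) := by
  set ω : ℝ := (volume (Metric.ball (0 : Ed d) 1)).toReal with hω
  have hω0 : 0 < ω := ENNReal.toReal_pos (Metric.measure_ball_pos _ _ one_pos).ne'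
    measure_ball_lt_top.ne
  have hωe : volume (Metric.ball (0 : Ed d) 1) = ENNReal.ofReal ω :=
    (ENNReal.ofReal_toReal measure_ball_lt_top.ne).symm
  obtain ⟨e, rfl⟩ : ∃ e, d = e + 1 := ⟨d - 1, by omega⟩
  refine ⟨(10 * D) ^ e / (r ^ (e + 1) * ω), by positivity, fun s hs => ?_⟩
  obtain ⟨u, huA, hdisj, hcov⟩ := Vitali.exists_disjoint_subfamily_covering_enlargement_closedBall
    A (fun a => a) (fun _ => s * D) (s * D) (fun _ _ => le_rfl) 5 (by norm_num)
  have hsub : ∀ a ∈ u, Metric.ball (a + s • (x₀ - a)) (s * r) ⊆ Metric.closedBall a (s * D) := by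
    intro a ha x hx
    rw [mem_closedBall_iff_norm]
    exact (dist_lt_of_mem_contracted_ball hs (hD a (huA ha)) hx).le
  have hdisj' : u.PairwiseDisjoint fun a => Metric.ball (a + s • (x₀ - a)) (s * r) := by
    intro a ha b hb hab
    exact (hdisj ha hb hab).mono (hsub a ha) (hsub b hb)
  have hcount : u.Countable := hdisj'.countable_of_isOpen (fun _ _ => Metric.isOpen_ball)
    fun i _ => Metric.nonempty_ball.2 (by positivity)
  refine ⟨u, hcount, fun a ha => ?_, ?_⟩
  · obtain ⟨b, hb, hab⟩ := hcov a ha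
    exact Set.mem_iUnion.2 ⟨⟨b, hb⟩, hab (Metric.mem_closedBall_self (by positivity))⟩
  have : Countable u := hcount.to_subtype
  have hball : ∀ i : u, Metric.ediam (Metric.closedBall (i : Ed (e + 1)) (5 * (s * D)))
      ^ (((e + 1 : ℕ) : ℝ) - 1) * ENNReal.ofReal s ≤
      ENNReal.ofReal ((10 * D) ^ e / (r ^ (e + 1) * ω)) *
        volume (Metric.ball ((i : Ed (e + 1)) + s • (x₀ - i)) (s * r)) := by
    intro i
    rw [Measure.addHaar_ball_of_pos _ _ (by positivity), hωe, finrank_euclideanSpace_fin]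
    have h1 : Metric.ediam (Metric.closedBall (i : Ed (e + 1)) (5 * (s * D)))
        ≤ ENNReal.ofReal (10 * (s * D)) := ediam_closedBall_five_le _ _
    have h2 : ((e + 1 : ℕ) : ℝ) - 1 = (e : ℝ) := by push_cast; ring
    rw [h2, ENNReal.rpow_natCast]
    calc _ ≤ ENNReal.ofReal (10 * (s * D)) ^ e * ENNReal.ofReal s := by gcongr
      _ = ENNReal.ofReal ((10 * (s * D)) ^ e * s) := by
        rw [← ENNReal.ofReal_pow (by positivity), ← ENNReal.ofReal_mul (by positivity)]
      _ = ENNReal.ofReal ((10 * D) ^ e / (r ^ (e + 1) * ω) * ((s * r) ^ (e + 1) * ω)) := by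
        congr 1
        field_simp
        ring
      _ = _ := by rw [ENNReal.ofReal_mul (by positivity), ENNReal.ofReal_mul (by positivity)]
  rw [← ENNReal.tsum_mul_right]
  calc _ ≤ ∑' i : u, ENNReal.ofReal ((10 * D) ^ e / (r ^ (e + 1) * ω)) *
        volume (Metric.ball ((i : Ed (e + 1)) + s • (x₀ - i)) (s * r)) :=
        ENNReal.tsum_le_tsum hball
    _ = ENNReal.ofReal ((10 * D) ^ e / (r ^ (e + 1) * ω)) *
        ∑' i : u, volume (Metric.ball ((i : Ed (e + 1)) + s • (x₀ - i)) (s * r)) :=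
        ENNReal.tsum_mul_left
    _ ≤ _ := by
      gcongr
      refine (tsum_meas_le_meas_iUnion_of_disjoint _ (fun _ => Metric.isOpen_ball.measurableSet)
        ?_).trans (measure_mono ?_)
      · exact fun i j hij => hdisj' i.2 j.2 (fun h => hij (Subtype.ext h))
      · exact Set.iUnion_subset fun i => Set.subset_biUnion_of_mem
          (u := fun a => Metric.ball (a + s • (x₀ - a)) (s * r)) (huA i.2)

lemma hausdorffMeasure_eq_zero_of_volume_coneNbhd {d : ℕ} (hd : 1 ≤ d) (A : Set (Ed d))
    (x₀ : Ed d) {r D : ℝ} (hr : 0 < r) (hD : ∀ a ∈ A, ‖x₀ - a‖ + r ≤ D) (hD0 : 0 < D)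
    (h : ∀ c : ℝ, 0 < c → ∀ᶠ s in 𝓝[>] (0 : ℝ),
      volume (coneNbhd A x₀ r s) ≤ ENNReal.ofReal (c * s)) :
    μH[(d : ℝ) - 1] A = 0 := by
  obtain ⟨k, hk, hcover⟩ := exists_cover_of_coneNbhd hd A x₀ hr hD hD0
  have hs : ∀ n : ℕ, (0 : ℝ) < 1 / ((n : ℝ) + 1) := fun n => by positivity
  have hlim : Tendsto (fun n : ℕ => 1 / ((n : ℝ) + 1)) atTop (𝓝[>] 0) :=
    tendsto_nhdsWithin_iff.2 ⟨tendsto_one_div_add_atTop_nhds_zero_nat, .of_forall hs⟩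
  choose u hu hcov hsum using fun n : ℕ => hcover _ (hs n)
  have (n : ℕ) : Countable (u n) := (hu n).to_subtype
  refine nonpos_iff_eq_zero.1 (ENNReal.le_of_forall_pos_le_add fun ε hε _ => ?_)
  rw [zero_add]
  refine (Measure.hausdorffMeasure_le_liminf_tsum ((d : ℝ) - 1) A (l := atTop)
    (ι := fun n => u n) (fun n : ℕ => ENNReal.ofReal (10 * (1 / ((n : ℝ) + 1) * D))) ?_
    (fun n i => Metric.closedBall (i : Ed d) (5 * (1 / ((n : ℝ) + 1) * D))) ?_
    (.of_forall hcov)).trans ?_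
  · rw [← ENNReal.ofReal_zero]
    refine ENNReal.tendsto_ofReal ?_
    have := ((tendsto_one_div_add_atTop_nhds_zero_nat (𝕜 := ℝ)).mul_const D).const_mul 10
    simpa using this
  · exact .of_forall fun n i => ediam_closedBall_five_le _ _
  · refine liminf_le_of_frequently_le' (Eventually.frequently ?_)
    filter_upwards [hlim.eventually (h (ε / k) (by positivity))] with n hn
    have h0 : ENNReal.ofReal (1 / ((n : ℝ) + 1)) ≠ 0 := by simpa using (hs n)
    rw [← ENNReal.mul_le_mul_iff_left h0 ENNReal.ofReal_ne_top]
    calc _ ≤ _ := hsum n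
      _ ≤ ENNReal.ofReal k * ENNReal.ofReal (ε / k * (1 / ((n : ℝ) + 1))) := by gcongr
      _ = ε * ENNReal.ofReal (1 / ((n : ℝ) + 1)) := by
        rw [← ENNReal.ofReal_coe_nnreal, ← ENNReal.ofReal_mul hk.le,
          ← ENNReal.ofReal_mul (by positivity)]
        congr 1
        field_simp

lemma EConvexOn.convex_sublevel {d : ℕ} {u : Ed d → EReal} (hu : EConvexOn u) (M : ℝ) :
    Convex ℝ {x | u x ≤ (M : EReal)} := by
  intro x hx y hy s t hs ht hst
  have hs' : (0 : EReal) ≤ (s : EReal) := EReal.coe_nonneg.2 hs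
  have ht' : (0 : EReal) ≤ (t : EReal) := EReal.coe_nonneg.2 ht
  calc u (s • x + t • y) ≤ (s : EReal) * u x + (t : EReal) * u y := hu x y s t hs ht hst
    _ ≤ (s : EReal) * M + (t : EReal) * M :=
        add_le_add (mul_le_mul_of_nonneg_left hx hs') (mul_le_mul_of_nonneg_left hy ht')
    _ = ((s * M + t * M : ℝ) : EReal) := by push_cast; rfl
    _ = (M : EReal) := by rw [← add_mul, hst, one_mul]

lemma EReal.exists_nat_ge_of_lt_top {a : EReal} (ha : a < ⊤) : ∃ n : ℕ, a ≤ ((n : ℝ) : EReal) := by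
  obtain ⟨n, hn⟩ := exists_nat_ge a.toReal
  exact ⟨n, (EReal.le_coe_toReal ha.ne).trans (EReal.coe_le_coe_iff.2 hn)⟩

lemma EConvexOn.convex_domain {d : ℕ} {u : Ed d → EReal} (hu : EConvexOn u) :
    Convex ℝ {x | u x < ⊤} := by
  intro x hx y hy s t hs ht hst
  obtain ⟨n, hn⟩ := EReal.exists_nat_ge_of_lt_top (max_lt hx hy)
  exact (hu.convex_sublevel n ((le_max_left _ _).trans hn) ((le_max_right _ _).trans hn)
    hs ht hst).trans_lt (EReal.coe_lt_top _)

/-- A convex function attaining `⊥` is identically `⊥`. -/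
lemma EConvexOn.eq_bot {d : ℕ} {u : Ed d → EReal} (hu : EConvexOn u) {x : Ed d} (hx : u x = ⊥)
    (z : Ed d) : u z = ⊥ := by
  have h := hu x ((2 : ℝ) • z - x) (1 / 2) (1 / 2) (by norm_num) (by norm_num) (by norm_num)
  have hz : (1 / 2 : ℝ) • x + (1 / 2 : ℝ) • ((2 : ℝ) • z - x) = z := by module
  rw [hz, hx, EReal.coe_mul_bot_of_pos (by norm_num), EReal.bot_add] at h
  exact le_bot_iff.1 h

lemma add_smul_notMem_of_mem_frontier {d : ℕ} {Ω : Set (Ed d)} (hΩ : Convex ℝ Ω)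
    {x₀ a₀ a x : Ed d} {r δ : ℝ} (hδ : 0 < δ) (hr : 0 < r) (hball : Metric.ball x₀ r ⊆ Ω)
    (ha : a ∈ frontier Ω) (ha₀ : ‖a - a₀‖ < r / 2) (hx : ‖x - a‖ < δ) :
    x + (2 * δ / r) • (a₀ - x₀) ∉ Ω := by
  intro hy
  set t : ℝ := 2 * δ / r with ht
  have ht0 : 0 < t := by positivity
  set z : Ed d := a - (a₀ - x₀) + t⁻¹ • (a - x) with hz
  have hzball : z ∈ Metric.ball x₀ r := by
    rw [mem_ball_iff_norm]
    have h1 : z - x₀ = (a - a₀) + t⁻¹ • (a - x) := by rw [hz]; abel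
    have h2 : t⁻¹ * ‖a - x‖ < r / 2 := by
      rw [norm_sub_rev a x]
      calc t⁻¹ * ‖x - a‖ < t⁻¹ * δ := by gcongr
        _ = r / 2 := by rw [ht]; field_simp
    calc ‖z - x₀‖ ≤ ‖a - a₀‖ + ‖t⁻¹ • (a - x)‖ := by rw [h1]; exact norm_add_le _ _
      _ = ‖a - a₀‖ + t⁻¹ * ‖a - x‖ := by
        rw [norm_smul, Real.norm_of_nonneg (by positivity)]
      _ < r := by linarith
  have hzint : z ∈ interior Ω := interior_maximal hball Metric.isOpen_ball hzball
  have hcombo := hΩ.combo_self_interior_mem_interior hy hzint (a := 1 / (1 + t)) (b := t / (1 + t))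
    (by positivity) (by positivity) (by field_simp)
  have heq : (1 / (1 + t)) • (x + t • (a₀ - x₀)) + (t / (1 + t)) • z = a := by
    have h3 : t • (t⁻¹ • (a - x)) = a - x := smul_inv_smul₀ ht0.ne' _
    have h4 : (x + t • (a₀ - x₀)) + t • z = (1 + t) • a := by
      rw [hz, smul_add, h3]; module
    rw [div_eq_inv_mul, div_eq_inv_mul, mul_smul, mul_smul, ← smul_add, one_smul, h4]
    exact inv_smul_smul₀ (by positivity) _
  rw [heq] at hcombo
  exact ha.2 hcombo

lemma coneNbhd_subset {d : ℕ} {A K : Set (Ed d)} (hK : Convex ℝ K) (hA : A ⊆ K) {x₀ : Ed d}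
    {r s : ℝ} (hball : Metric.ball x₀ r ⊆ K) (hs : 0 < s) (hs1 : s ≤ 1) :
    coneNbhd A x₀ r s ⊆ K := by
  refine Set.iUnion₂_subset fun a ha x hx => ?_
  set z : Ed d := x₀ + s⁻¹ • (x - (a + s • (x₀ - a))) with hz
  have hzball : z ∈ Metric.ball x₀ r := by
    rw [mem_ball_iff_norm] at hx ⊢
    rw [hz, add_sub_cancel_left, norm_smul, Real.norm_of_nonneg (by positivity),
      inv_mul_lt_iff₀ hs]
    exact hx
  have h := hK (hA ha) (hball hzball) (a := 1 - s) (b := s) (by linarith) hs.le (by ring)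
  have heq : (1 - s) • a + s • z = x := by
    rw [hz, smul_add, smul_inv_smul₀ hs.ne']; module
  rwa [heq] at h

lemma exists_ball_subset_sublevel {d : ℕ} {u : Ed d → EReal} (hu : EConvexOn u)
    (h : volume {x | u x < ⊤} ≠ 0) :
    ∃ (n : ℕ) (x₀ : Ed d) (r : ℝ), 0 < r ∧ Metric.ball x₀ r ⊆ {x | u x ≤ ((n : ℝ) : EReal)} := by
  have hU : {x | u x < ⊤} = ⋃ n : ℕ, {x | u x ≤ ((n : ℝ) : EReal)} := by
    ext x
    simp only [Set.mem_ofPred_eq, Set.mem_iUnion]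
    exact ⟨EReal.exists_nat_ge_of_lt_top, fun ⟨n, hn⟩ => hn.trans_lt (EReal.coe_lt_top _)⟩
  rw [hU, Ne, measure_iUnion_null_iff, not_forall] at h
  obtain ⟨n, hn⟩ := h
  have hne : (interior {x | u x ≤ ((n : ℝ) : EReal)}).Nonempty := by
    rw [Set.nonempty_iff_ne_empty]
    intro hempty
    refine hn (measure_mono_null ?_ ((hu.convex_sublevel n).addHaar_frontier volume))
    rw [frontier, hempty, Set.sdiff_empty]
    exact subset_closure
  obtain ⟨x₀, hx₀⟩ := hne
  obtain ⟨r, hr, hsub⟩ := Metric.isOpen_iff.1 isOpen_interior x₀ hx₀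
  exact ⟨n, x₀, r, hr, hsub.trans interior_subset⟩

section SignedIntegral

variable {β : Type*} [MeasurableSpace β] {ν : Measure β} {g g' e : β → ℝ}

lemma sInt_eq_integral (hg : Integrable g ν) : sInt ν g = ((∫ x, g x ∂ν : ℝ) : EReal) := by
  have h1 : ∫⁻ x, ENNReal.ofReal (g x) ∂ν ≠ ⊤ := hg.lintegral_lt_top.ne
  have h2 : ∫⁻ x, ENNReal.ofReal (-(g x)) ∂ν ≠ ⊤ := hg.neg.lintegral_lt_top.ne
  rw [integral_eq_lintegral_pos_part_sub_lintegral_neg_part hg, EReal.coe_sub,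
    EReal.coe_ennreal_toReal h1, EReal.coe_ennreal_toReal h2]
  rfl

lemma sInt_congr (h : g =ᵐ[ν] g') : sInt ν g = sInt ν g' := by
  unfold sInt
  congr 2 <;> exact lintegral_congr_ae (h.mono fun x hx => by simp only [hx])

lemma integrable_of_lintegral_ne_top (hm : AEStronglyMeasurable g ν)
    (hp : ∫⁻ x, ENNReal.ofReal (g x) ∂ν ≠ ⊤) (hn : ∫⁻ x, ENNReal.ofReal (-(g x)) ∂ν ≠ ⊤) :
    Integrable g ν := by
  refine ⟨hm, ?_⟩
  rw [hasFiniteIntegral_iff_norm]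
  calc ∫⁻ x, ENNReal.ofReal ‖g x‖ ∂ν
      ≤ ∫⁻ x, (ENNReal.ofReal (g x) + ENNReal.ofReal (-(g x))) ∂ν := by
        refine lintegral_mono fun x => ?_
        rcases le_total 0 (g x) with h | h
        · rw [Real.norm_of_nonneg h]; exact le_self_add
        · rw [Real.norm_of_nonpos h]; exact le_add_self
    _ = ∫⁻ x, ENNReal.ofReal (g x) ∂ν + ∫⁻ x, ENNReal.ofReal (-(g x)) ∂ν :=
        lintegral_add_left' hm.aemeasurable.ennreal_ofReal _
    _ < ⊤ := ENNReal.add_lt_top.2 ⟨hp.lt_top, hn.lt_top⟩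

lemma sInt_ne_bot (hn : ∫⁻ x, ENNReal.ofReal (-(g x)) ∂ν ≠ ⊤) : sInt ν g ≠ ⊥ := by
  unfold sInt
  rw [← EReal.coe_ennreal_toReal hn, sub_eq_add_neg, Ne, EReal.add_eq_bot_iff, not_or]
  refine ⟨EReal.coe_ennreal_ne_bot _, ?_⟩
  rw [← EReal.coe_neg]
  exact EReal.coe_ne_bot _

lemma lintegral_pos_ne_top_of_sInt_ne_top (hn : ∫⁻ x, ENNReal.ofReal (-(g x)) ∂ν ≠ ⊤)
    (h : sInt ν g ≠ ⊤) : ∫⁻ x, ENNReal.ofReal (g x) ∂ν ≠ ⊤ := by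
  intro htop
  refine h ?_
  unfold sInt
  rw [← EReal.coe_ennreal_toReal hn, htop, EReal.coe_ennreal_top, EReal.top_sub_coe]

lemma integrable_of_sInt_ne_top (hm : AEStronglyMeasurable g ν)
    (hn : ∫⁻ x, ENNReal.ofReal (-(g x)) ∂ν ≠ ⊤) (h : sInt ν g ≠ ⊤) : Integrable g ν :=
  integrable_of_lintegral_ne_top hm (lintegral_pos_ne_top_of_sInt_ne_top hn h) hn

lemma sInt_le_of_le_ofReal {C : ℝ≥0∞} (h : ∫⁻ x, ENNReal.ofReal (g x) ∂ν ≤ C) :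
    sInt ν g ≤ C := by
  unfold sInt
  calc _ ≤ ((C : ℝ≥0∞) : EReal) - 0 :=
        EReal.sub_le_sub (EReal.coe_ennreal_le_coe_ennreal_iff.2 h) (EReal.coe_ennreal_nonneg _)
    _ = C := sub_zero _

lemma sInt_le_add (hg : AEStronglyMeasurable g ν) (hg' : AEStronglyMeasurable g' ν)
    (he : Integrable e ν) (h : ∀ x, |g x - g' x| ≤ e x) :
    sInt ν g ≤ sInt ν g' + ((∫ x, e x ∂ν : ℝ) : EReal) := by
  have hlin : ∀ k k' : β → ℝ, (∀ x, k' x ≤ k x + e x) → AEStronglyMeasurable k ν →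
      ∫⁻ x, ENNReal.ofReal (k x) ∂ν ≠ ⊤ → ∫⁻ x, ENNReal.ofReal (k' x) ∂ν ≠ ⊤ := by
    intro k k' hk hkm hfin
    refine ne_top_of_le_ne_top (ENNReal.add_ne_top.2 ⟨hfin, he.lintegral_lt_top.ne⟩) ?_
    rw [← lintegral_add_left' hkm.aemeasurable.ennreal_ofReal]
    exact lintegral_mono fun x => (ENNReal.ofReal_le_ofReal (hk x)).trans ENNReal.ofReal_add_le
  by_cases hn : ∫⁻ x, ENNReal.ofReal (-(g' x)) ∂ν = ⊤
  · have hn' : ∫⁻ x, ENNReal.ofReal (-(g x)) ∂ν = ⊤ := by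
      by_contra hne
      exact hlin (fun x => -(g x)) (fun x => -(g' x))
        (fun x => by linarith [(abs_le.1 (h x)).2]) hg.neg hne hn
    have : sInt ν g = ⊥ := by
      unfold sInt
      rw [hn', EReal.coe_ennreal_top, EReal.sub_top]
    rw [this]
    exact bot_le
  · by_cases hp : sInt ν g' = ⊤
    · rw [hp, EReal.top_add_coe]
      exact le_top
    · have hig' := integrable_of_sInt_ne_top hg' hn hp
      have hig : Integrable g ν := by
        refine integrable_of_lintegral_ne_top hg
          (hlin g' g (fun x => by linarith [(abs_le.1 (h x)).2]) hg' hig'.lintegral_lt_top.ne)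
          (hlin (fun x => -(g' x)) (fun x => -(g x))
            (fun x => by linarith [(abs_le.1 (h x)).1]) hg'.neg hn)
      rw [sInt_eq_integral hig, sInt_eq_integral hig', ← EReal.coe_add, ← integral_add hig' he]
      exact EReal.coe_le_coe_iff.2
        (integral_mono hig (hig'.add he) fun x => by
          have := (abs_le.1 (h x)).2
          simp only
          linarith)

end SignedIntegral

lemma Ent_withDensity {d : ℕ} {g : Ed d → ℝ} (hg : Measurable g) (hg0 : ∀ x, 0 ≤ g x) :
    Ent ((volume : Measure (Ed d)).withDensity fun x => ENNReal.ofReal (g x)) =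
      sInt volume fun x => g x * Real.log (g x) := by
  unfold Ent
  rw [dif_pos (withDensity_absolutelyContinuous _ _)]
  refine sInt_congr ?_
  filter_upwards [Measure.rnDeriv_withDensity (volume : Measure (Ed d)) hg.ennreal_ofReal] with x hx
  rw [hx, ENNReal.toReal_ofReal (hg0 x)]

/-- The negative part of the entropy of a density with finite first moment is finite. -/
lemma lintegral_neg_mul_log_ne_top {d : ℕ} {g : Ed d → ℝ} (hg0 : ∀ x, 0 ≤ g x)
    (hg : Integrable (fun x => ‖x‖ * g x) volume) :
    ∫⁻ x, ENNReal.ofReal (-(g x * Real.log (g x))) ≠ ⊤ := by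
  set k : Ed d → ℝ := fun x => (1 + ‖x‖) ^ (-((d : ℝ) + 1)) with hk
  have hki : Integrable k volume := integrable_one_add_norm (by simp)
  have hb : ∀ x, -(g x * Real.log (g x)) ≤ 2 * ((d : ℝ) + 1) * (‖x‖ * g x) + 2 * k x := by
    intro x
    have hk0 : 0 < k x := by positivity
    rcases (hg0 x).eq_or_lt with h0 | h0
    · rw [← h0]
      simp only [zero_mul, neg_zero, mul_zero, zero_add]
      positivity
    have hlogk : -Real.log (k x) ≤ ((d : ℝ) + 1) * ‖x‖ := by
      rw [hk]
      simp only
      rw [Real.log_rpow (by positivity)]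
      have := Real.log_le_sub_one_of_pos (show 0 < 1 + ‖x‖ by positivity)
      nlinarith [norm_nonneg x]
    set q := Real.sqrt (g x) with hq
    have hq0 : 0 < q := Real.sqrt_pos.2 h0
    have hqq : g x = q * q := (Real.mul_self_sqrt h0.le).symm
    have hlogg : Real.log (g x) = 2 * Real.log q := by
      rw [hqq, Real.log_mul hq0.ne' hq0.ne']; ring
    have hkq : Real.log (k x) - Real.log q ≤ k x / q - 1 := by
      rw [← Real.log_div hk0.ne' hq0.ne']
      exact Real.log_le_sub_one_of_pos (by positivity)
    have hneg : -Real.log (g x) ≤ 2 * ((d : ℝ) + 1) * ‖x‖ + 2 * (k x / q - 1) := by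
      rw [hlogg]; linarith
    have hk1 : k x ≤ 1 :=
      Real.rpow_le_one_of_one_le_of_nonpos (by linarith [norm_nonneg x])
        (by linarith [d.cast_nonneg (α := ℝ)])
    calc -(g x * Real.log (g x)) = g x * -Real.log (g x) := by ring
      _ ≤ g x * (2 * ((d : ℝ) + 1) * ‖x‖ + 2 * (k x / q - 1)) :=
          mul_le_mul_of_nonneg_left hneg h0.le
      _ = 2 * ((d : ℝ) + 1) * (‖x‖ * g x) + 2 * (k x * q - q * q) := by
          rw [hqq]; field_simp
      _ ≤ 2 * ((d : ℝ) + 1) * (‖x‖ * g x) + 2 * k x := by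
          nlinarith [sq_nonneg (k x - 2 * q)]
  refine ne_top_of_le_ne_top ?_ (lintegral_mono fun x => ENNReal.ofReal_le_ofReal (hb x))
  exact ((hg.const_mul _).add (hki.const_mul _)).lintegral_lt_top.ne

lemma maxCorr_ne_bot {d : ℕ} {ρ μ : Measure (Ed d)} (hρ : ρ ∈ P1 d) (hμ : μ ∈ P1 d) :
    maxCorr ρ μ ≠ ⊥ := by
  obtain ⟨hρp, hρi⟩ := hρ
  obtain ⟨hμp, hμi⟩ := hμ
  have hγ : ρ.prod μ ∈ couplings ρ μ := by
    refine ⟨inferInstance, ?_, ?_⟩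
    · simp [Measure.map_fst_prod]
    · simp [Measure.map_snd_prod]
  have hgint : Integrable (fun p : Ed d × Ed d => ⟪p.1, p.2⟫) (ρ.prod μ) :=
    (hρi.mul_prod hμi).mono' (by fun_prop)
      (.of_forall fun p => norm_inner_le_norm p.1 p.2)
  refine ne_bot_of_le_ne_bot ?_ (le_iSup₂ (f := fun γ _ => sInt γ
    (fun p : Ed d × Ed d => ⟪p.1, p.2⟫)) (ρ.prod μ) hγ)
  rw [sInt_eq_integral hgint]
  exact EReal.coe_ne_bot _

lemma maxCorr_ne_top_of_ae_bounded {d : ℕ} {σ μ : Measure (Ed d)} (hμ : μ ∈ P1 d)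
    (hσ : ∀ᵐ x ∂σ, ‖x‖ ≤ 1) : maxCorr σ μ ≠ ⊤ := by
  have hfin : ∫⁻ y, ENNReal.ofReal ‖y‖ ∂μ ≠ ⊤ := hμ.2.lintegral_lt_top.ne
  refine ne_top_of_le_ne_top
    (show ((∫⁻ y, ENNReal.ofReal ‖y‖ ∂μ : ℝ≥0∞) : EReal) ≠ ⊤ by
      rwa [Ne, EReal.coe_ennreal_eq_top_iff]) (iSup₂_le fun γ hγ => ?_)
  obtain ⟨_, h1, h2⟩ := hγ
  refine sInt_le_of_le_ofReal ?_
  rw [← h1] at hσ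
  have hσ' := ae_of_ae_map measurable_fst.aemeasurable hσ
  rw [← h2, lintegral_map (by fun_prop) measurable_snd]
  refine lintegral_mono_ae (hσ'.mono fun p hp => ENNReal.ofReal_le_ofReal ?_)
  calc ⟪p.1, p.2⟫ ≤ ‖p.1‖ * ‖p.2‖ := real_inner_le_norm _ _
    _ ≤ 1 * ‖p.2‖ := by gcongr
    _ = ‖p.2‖ := one_mul _

lemma exists_Ffun_ne_top {d : ℕ} (α : ℝ) {μ : Measure (Ed d)} (hμ : μ ∈ P1 d) :
    ∃ σ ∈ P1 d, Ffun α μ σ ≠ ⊤ := by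
  set B : Set (Ed d) := Metric.closedBall 0 1 with hB
  have hBm : MeasurableSet B := Metric.isClosed_closedBall.measurableSet
  have hBfin : volume B ≠ ⊤ := measure_closedBall_lt_top.ne
  have hB0 : 0 < (volume B).toReal :=
    ENNReal.toReal_pos (Metric.measure_closedBall_pos _ _ one_pos).ne' hBfin
  set c : ℝ := (volume B).toReal⁻¹ with hc
  set g : Ed d → ℝ := B.indicator fun _ => c with hg
  have hgm : Measurable g := measurable_const.indicator hBm
  have hg0 : ∀ x, 0 ≤ g x := fun x => Set.indicator_nonneg (fun _ _ => by positivity) x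
  set σ : Measure (Ed d) := volume.withDensity fun x => ENNReal.ofReal (g x) with hσ
  have hσ' : σ = ENNReal.ofReal c • volume.restrict B := by
    rw [hσ, ← withDensity_const, ← withDensity_indicator hBm]
    congr 1
    ext x
    by_cases hx : x ∈ B <;> simp [hg, hx]
  have hσB : ∀ᵐ x ∂σ, ‖x‖ ≤ 1 := by
    rw [hσ']
    refine Measure.ae_smul_measure ?_ _
    filter_upwards [ae_restrict_mem hBm] with x hx
    exact mem_closedBall_zero_iff.1 hx
  have hprob : IsProbabilityMeasure σ := by
    refine ⟨?_⟩
    rw [hσ', Measure.smul_apply, Measure.restrict_apply_univ, smul_eq_mul, hc,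
      ENNReal.ofReal_inv_of_pos hB0, ENNReal.ofReal_toReal hBfin]
    exact ENNReal.inv_mul_cancel (Metric.measure_closedBall_pos _ _ one_pos).ne' hBfin
  have hlog : Integrable (fun x => g x * Real.log (g x)) volume := by
    have : (fun x => g x * Real.log (g x)) = B.indicator fun _ => c * Real.log c := by
      ext x
      by_cases hx : x ∈ B <;> simp [hg, hx]
    rw [this]
    exact (integrableOn_const hBfin).integrable_indicator hBm
  refine ⟨σ, ⟨hprob, ?_⟩, ?_⟩
  · exact (integrable_const (1 : ℝ)).mono' (by fun_prop) (hσB.mono fun x hx => by simpa using hx)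
  · have hM2 : M2e σ ≠ ⊤ := by
      refine ne_top_of_le_ne_top one_ne_top ?_
      calc M2e σ ≤ ∫⁻ _, 1 ∂σ := lintegral_mono_ae (hσB.mono fun x hx => by
            rw [← ENNReal.ofReal_one]
            exact ENNReal.ofReal_le_ofReal (pow_le_one₀ (norm_nonneg _) hx))
        _ = 1 := by simp
    unfold Ffun
    rw [hσ, Ent_withDensity hgm hg0, sInt_eq_integral hlog, ← hσ]
    refine EReal.add_ne_top (EReal.add_ne_top (EReal.coe_ne_top _)
      (maxCorr_ne_top_of_ae_bounded hμ hσB)) ?_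
    rw [← EReal.coe_ennreal_toReal hM2, ← EReal.coe_mul]
    exact EReal.coe_ne_top _

/-- Along a minimizer with density `g`, each of the three terms of the functional is finite. -/
lemma IsMinOfF.terms_finite {d : ℕ} {α : ℝ} (hα : 0 < α) {μ ρ : Measure (Ed d)}
    (hμ : μ ∈ P1 d) (hmin : IsMinOfF α μ ρ) {g : Ed d → ℝ} (hg : Measurable g)
    (hg0 : ∀ x, 0 ≤ g x) (hρ : ρ = volume.withDensity fun x => ENNReal.ofReal (g x)) :
    Integrable (fun x => g x * Real.log (g x)) volume ∧ (∃ τ : ℝ, maxCorr ρ μ = τ) ∧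
      M2e ρ ≠ ⊤ := by
  obtain ⟨σ, hσ, hσF⟩ := exists_Ffun_ne_top α hμ
  have hF : Ffun α μ ρ ≠ ⊤ := ne_top_of_le_ne_top hσF (hmin.2 σ hσ)
  have hxg : Integrable (fun x => ‖x‖ * g x) volume := by
    have h := hmin.1.2
    rw [hρ, integrable_withDensity_iff hg.ennreal_ofReal (.of_forall fun _ => ofReal_lt_top)] at h
    simpa only [ENNReal.toReal_ofReal (hg0 _)] using h
  have hneg := lintegral_neg_mul_log_ne_top hg0 hxg
  have hEnt : Ent ρ = sInt volume fun x => g x * Real.log (g x) := by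
    rw [hρ]; exact Ent_withDensity hg hg0
  have hEbot : Ent ρ ≠ ⊥ := hEnt ▸ sInt_ne_bot hneg
  have hTbot := maxCorr_ne_bot hmin.1 hμ
  have hα2 : (0 : ℝ) < α / 2 := by positivity
  have hMbot : ((α / 2 : ℝ) : EReal) * ((M2e ρ : ℝ≥0∞) : EReal) ≠ ⊥ :=
    ne_bot_of_le_ne_bot EReal.zero_ne_bot
      (mul_nonneg (EReal.coe_nonneg.2 hα2.le) (EReal.coe_ennreal_nonneg _))
  unfold Ffun at hF
  rw [EReal.add_ne_top_iff_ne_top₂ (EReal.add_ne_bot_iff.2 ⟨hEbot, hTbot⟩) hMbot,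
    EReal.add_ne_top_iff_ne_top₂ hEbot hTbot] at hF
  obtain ⟨⟨hEtop, hTtop⟩, hMtop⟩ := hF
  refine ⟨integrable_of_sInt_ne_top (by fun_prop) hneg (hEnt ▸ hEtop),
    ⟨(maxCorr ρ μ).toReal, (EReal.coe_toReal hTtop hTbot).symm⟩, fun h => hMtop ?_⟩
  rw [h, EReal.coe_ennreal_top, EReal.coe_mul_top_of_pos hα2]

/-- The measure obtained from `ρ` by translating by `w` half of the mass carried by `S`. -/
def spread {d : ℕ} (ρ : Measure (Ed d)) (S : Set (Ed d)) (w : Ed d) : Measure (Ed d) :=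
  ρ.restrict Sᶜ + (2⁻¹ : ℝ≥0∞) • ρ.restrict S + (2⁻¹ : ℝ≥0∞) • (ρ.restrict S).map (· + w)

/-- The density of `spread`, in terms of the density `g` of the original measure. -/
def spreadDensity {d : ℕ} (g : Ed d → ℝ) (S : Set (Ed d)) (w x : Ed d) : ℝ :=
  Sᶜ.indicator g x + 2⁻¹ * S.indicator g x + 2⁻¹ * S.indicator g (x - w)

/-- The map sending the translated mass of `spread` back to where it came from. -/
def unspread {d : ℕ} (S : Set (Ed d)) (w x : Ed d) : Ed d := by
  classical
  exact if x - w ∈ S then x - w else x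

section Spread

variable {d : ℕ} {ρ μ : Measure (Ed d)} {S : Set (Ed d)} {w : Ed d} {g : Ed d → ℝ}

lemma lintegral_spread {G : Ed d → ℝ≥0∞} (hG : Measurable G) :
    ∫⁻ x, G x ∂(spread ρ S w) = ∫⁻ x in Sᶜ, G x ∂ρ + 2⁻¹ * ∫⁻ x in S, G x ∂ρ +
      2⁻¹ * ∫⁻ x in S, G (x + w) ∂ρ := by
  unfold spread
  rw [lintegral_add_measure, lintegral_add_measure, lintegral_smul_measure,
    lintegral_smul_measure, lintegral_map hG (by fun_prop)]
  rfl

lemma half_add_half (a : ℝ≥0∞) : 2⁻¹ * a + 2⁻¹ * a = a := by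
  rw [← add_mul, ENNReal.inv_two_add_inv_two, one_mul]

lemma isProbabilityMeasure_spread [IsProbabilityMeasure ρ] (hS : MeasurableSet S) :
    IsProbabilityMeasure (spread ρ S w) := by
  refine ⟨?_⟩
  rw [← lintegral_one, lintegral_spread measurable_const, add_assoc, half_add_half, add_comm,
    lintegral_add_compl _ hS, lintegral_one, measure_univ]

lemma spread_mem_P1 (hρ : ρ ∈ P1 d) (hS : MeasurableSet S) : spread ρ S w ∈ P1 d := by
  obtain ⟨hp, hi⟩ := hρ
  refine ⟨isProbabilityMeasure_spread hS, ?_⟩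
  refine ((hi.restrict).add_measure (hi.restrict.smul_measure (by simp))).add_measure
    (Integrable.smul_measure ?_ (by simp))
  rw [integrable_map_measure (by fun_prop) (by fun_prop)]
  refine (hi.restrict.add (integrable_const ‖w‖)).mono' (by fun_prop) (.of_forall fun x => ?_)
  simpa using norm_add_le x w

lemma M2e_spread_le {R : ℝ} (hS : MeasurableSet S) (hR : ∀ x ∈ S, ‖x‖ ≤ R) (hw : ‖w‖ ≤ 1) :
    M2e (spread ρ S w) ≤ M2e ρ + ENNReal.ofReal ((2 * R + 1) * ‖w‖) * ρ S := by
  unfold M2e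
  rw [lintegral_spread (by fun_prop)]
  have h1 : ∫⁻ x in S, ENNReal.ofReal (‖x + w‖ ^ 2) ∂ρ ≤
      ∫⁻ x in S, ENNReal.ofReal (‖x‖ ^ 2) ∂ρ + ENNReal.ofReal ((2 * R + 1) * ‖w‖) * ρ S := by
    rw [← setLIntegral_const, ← lintegral_add_right _ measurable_const]
    refine setLIntegral_mono' hS fun x hx => ?_
    refine (ENNReal.ofReal_le_ofReal ?_).trans ENNReal.ofReal_add_le
    have h2 := norm_add_le x w
    have h3 : ‖x + w‖ ^ 2 ≤ (‖x‖ + ‖w‖) ^ 2 := by gcongr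
    nlinarith [hR x hx, norm_nonneg w, norm_nonneg x]
  have h4 : (2⁻¹ : ℝ≥0∞) * (ENNReal.ofReal ((2 * R + 1) * ‖w‖) * ρ S) ≤
      ENNReal.ofReal ((2 * R + 1) * ‖w‖) * ρ S := mul_le_of_le_one_left' (by simp)
  calc _ ≤ ∫⁻ x in Sᶜ, ENNReal.ofReal (‖x‖ ^ 2) ∂ρ +
        2⁻¹ * ∫⁻ x in S, ENNReal.ofReal (‖x‖ ^ 2) ∂ρ +
        2⁻¹ * (∫⁻ x in S, ENNReal.ofReal (‖x‖ ^ 2) ∂ρ +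
          ENNReal.ofReal ((2 * R + 1) * ‖w‖) * ρ S) := by gcongr
    _ = (∫⁻ x in S, ENNReal.ofReal (‖x‖ ^ 2) ∂ρ + ∫⁻ x in Sᶜ, ENNReal.ofReal (‖x‖ ^ 2) ∂ρ) +
        2⁻¹ * (ENNReal.ofReal ((2 * R + 1) * ‖w‖) * ρ S) := by
      nth_rw 3 [← half_add_half (∫⁻ x in S, ENNReal.ofReal (‖x‖ ^ 2) ∂ρ)]
      ring
    _ ≤ _ := by
      rw [lintegral_add_compl _ hS]
      gcongr

lemma spread_eq_withDensity (hg : Measurable g) (hg0 : ∀ x, 0 ≤ g x)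
    (hρ : ρ = volume.withDensity fun x => ENNReal.ofReal (g x)) (hS : MeasurableSet S) :
    spread ρ S w = volume.withDensity fun x => ENNReal.ofReal (spreadDensity g S w x) := by
  have hind : ∀ (A : Set (Ed d)) x, 0 ≤ A.indicator g x := fun A x =>
    Set.indicator_nonneg (fun _ _ => hg0 _) x
  have hres : ∀ {A : Set (Ed d)}, MeasurableSet A →
      ρ.restrict A = volume.withDensity fun x => ENNReal.ofReal (A.indicator g x) := by
    intro A hA
    rw [hρ, restrict_withDensity hA, ← withDensity_indicator hA]
    congr 1
    ext x
    by_cases hx : x ∈ A <;> simp [hx]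
  have hm : ∀ {A : Set (Ed d)}, MeasurableSet A →
      Measurable fun x => ENNReal.ofReal (A.indicator g x) := fun hA =>
    (hg.indicator hA).ennreal_ofReal
  have hmap : (ρ.restrict S).map (· + w) =
      volume.withDensity fun x => ENNReal.ofReal (S.indicator g (x - w)) := by
    ext B hB
    rw [Measure.map_apply (by fun_prop) hB, hres hS,
      withDensity_apply _ (measurable_add_const w hB), withDensity_apply _ hB,
      ← lintegral_indicator (measurable_add_const w hB), ← lintegral_indicator hB,
      ← lintegral_sub_right_eq_self _ w]
    refine lintegral_congr fun x => ?_
    by_cases hx : x ∈ B <;> simp [hx]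
  have hm' : Measurable fun x => ENNReal.ofReal (S.indicator g (x - w)) :=
    (hm hS).comp (measurable_sub_const w)
  have h2 : (2⁻¹ : ℝ≥0∞) = ENNReal.ofReal 2⁻¹ := by
    rw [ENNReal.ofReal_inv_of_pos two_pos, ENNReal.ofReal_ofNat]
  unfold spread
  rw [hmap, hres hS, hres hS.compl, ← withDensity_smul _ (hm hS), ← withDensity_smul _ hm',
    ← withDensity_add_left (hm hS.compl), ← withDensity_add_left ((hm hS.compl).add
      ((hm hS).const_smul _))]
  congr 1
  ext x
  simp only [Pi.add_apply, Pi.smul_apply, smul_eq_mul, spreadDensity]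
  rw [h2, ENNReal.ofReal_add (add_nonneg (hind _ _) (mul_nonneg (by norm_num) (hind _ _)))
      (mul_nonneg (by norm_num) (hind _ _)),
    ENNReal.ofReal_add (hind _ _) (mul_nonneg (by norm_num) (hind _ _)),
    ENNReal.ofReal_mul (by norm_num), ENNReal.ofReal_mul (by norm_num)]

lemma Ent_spread (hg : Measurable g) (hg0 : ∀ x, 0 ≤ g x)
    (hρ : ρ = volume.withDensity fun x => ENNReal.ofReal (g x)) (hS : MeasurableSet S)
    (hgint : Integrable g volume)
    (hlog : Integrable (fun x => g x * Real.log (g x)) volume) (hzero : ∀ x ∈ S, g (x + w) = 0) :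
    Ent (spread ρ S w) =
      (((∫ x, g x * Real.log (g x)) - Real.log 2 * ∫ x in S, g x : ℝ) : EReal) := by
  set q : Ed d → ℝ :=
    S.indicator fun x => 2⁻¹ * (g x * Real.log (g x)) - 2⁻¹ * Real.log 2 * g x with hq
  have hqi : Integrable q volume :=
    ((hlog.const_mul _).sub (hgint.const_mul _)).indicator hS
  have hhalf : ∀ t : ℝ, 0 ≤ t → 2⁻¹ * t * Real.log (2⁻¹ * t) =
      2⁻¹ * (t * Real.log t) - 2⁻¹ * Real.log 2 * t := by
    intro t ht
    rcases ht.eq_or_lt with rfl | ht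
    · simp
    · rw [Real.log_mul (by norm_num) ht.ne', Real.log_inv]; ring
  have hpt : ∀ x, spreadDensity g S w x * Real.log (spreadDensity g S w x) =
      Sᶜ.indicator (fun x => g x * Real.log (g x)) x + q x + q (x - w) := by
    intro x
    by_cases hxw : x - w ∈ S
    · have hgx : g x = 0 := by simpa using hzero _ hxw
      by_cases hx : x ∈ S <;> simp [spreadDensity, hq, hx, hxw, hgx, hhalf _ (hg0 _)]
    · by_cases hx : x ∈ S <;> simp [spreadDensity, hq, hx, hxw, hhalf _ (hg0 _)]
  have hc : Integrable (Sᶜ.indicator (fun x => g x * Real.log (g x))) volume :=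
    hlog.indicator hS.compl
  have hqw : Integrable (fun x => q (x - w)) volume := hqi.comp_sub_right w
  have hm : Measurable (spreadDensity g S w) := by
    unfold spreadDensity
    have h1 := hg.indicator hS
    have h2 := hg.indicator hS.compl
    have h3 : Measurable fun x => S.indicator g (x - w) := h1.comp (measurable_sub_const w)
    fun_prop
  have hnn : ∀ x, 0 ≤ spreadDensity g S w x := by
    intro x
    have hind : ∀ (A : Set (Ed d)) x, 0 ≤ A.indicator g x := fun A x =>
      Set.indicator_nonneg (fun _ _ => hg0 _) x
    have := hind S x; have := hind S (x - w); have := hind Sᶜ x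
    unfold spreadDensity
    positivity
  rw [spread_eq_withDensity hg hg0 hρ hS, Ent_withDensity hm hnn]
  simp_rw [hpt]
  have hsum : Integrable (fun x => Sᶜ.indicator (fun x => g x * Real.log (g x)) x + q x) volume :=
    hc.add hqi
  have hsum' : Integrable (fun x => Sᶜ.indicator (fun x => g x * Real.log (g x)) x + q x +
      q (x - w)) volume := hsum.add hqw
  rw [sInt_eq_integral hsum', integral_add hsum hqw, integral_add hc hqi,
    integral_sub_right_eq_self, integral_indicator hS.compl]
  congr 1
  have hqv : ∫ x, q x = 2⁻¹ * (∫ x in S, g x * Real.log (g x)) -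
      2⁻¹ * Real.log 2 * ∫ x in S, g x := by
    rw [hq, integral_indicator hS, integral_sub (hlog.const_mul _).integrableOn
      (hgint.const_mul _).integrableOn, integral_const_mul, integral_const_mul]
  rw [hqv, ← integral_add_compl hS hlog]
  ring

lemma measurable_unspread (hS : MeasurableSet S) : Measurable (unspread S w) :=
  Measurable.ite (measurable_sub_const w hS) (measurable_sub_const w) measurable_id

lemma map_unspread_spread (hS : MeasurableSet S) (hzero : ∀ᵐ x ∂ρ, x - w ∉ S) :
    (spread ρ S w).map (unspread S w) = ρ := by
  have hψ := measurable_unspread (w := w) hS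
  have hid : ∀ A : Set (Ed d), (ρ.restrict A).map (unspread S w) = ρ.restrict A := by
    intro A
    rw [Measure.map_congr (g := id), Measure.map_id]
    filter_upwards [ae_restrict_of_ae hzero] with x hx
    simp [unspread, hx]
  have hback : ((ρ.restrict S).map (· + w)).map (unspread S w) = ρ.restrict S := by
    rw [Measure.map_map hψ (by fun_prop), Measure.map_congr (g := id), Measure.map_id]
    filter_upwards [ae_restrict_mem hS] with x hx
    simp [unspread, hx]
  unfold spread
  rw [Measure.map_add _ _ hψ, Measure.map_add _ _ hψ, Measure.map_smul, Measure.map_smul, hid, hid,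
    hback, add_assoc, ← add_smul, ENNReal.inv_two_add_inv_two, one_smul, add_comm,
    Measure.restrict_add_restrict_compl hS]

lemma spread_apply_translate_le (hS : MeasurableSet S) (hzero : ∀ᵐ x ∂ρ, x - w ∉ S) :
    spread ρ S w ((· - w) ⁻¹' S) ≤ ρ S := by
  have hW : MeasurableSet ((· - w) ⁻¹' S) := measurable_sub_const w hS
  have h0 : ρ ((· - w) ⁻¹' S) = 0 := by
    have h := ae_iff.1 hzero
    simp only [not_not] at h
    exact h
  have hr : ∀ A : Set (Ed d), ρ.restrict A ((· - w) ⁻¹' S) = 0 := fun A =>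
    nonpos_iff_eq_zero.1 (h0 ▸ Measure.restrict_apply_le _ _)
  unfold spread
  rw [Measure.add_apply, Measure.add_apply, Measure.smul_apply, Measure.smul_apply, hr, hr,
    smul_zero, zero_add, zero_add, Measure.map_apply (by fun_prop) hW, smul_eq_mul]
  calc _ ≤ 1 * ρ.restrict S Set.univ := by
        gcongr
        · simp
        · exact Set.subset_univ _
    _ = ρ S := by simp

lemma maxCorr_spread_le [IsProbabilityMeasure ρ] (hμ : μ ∈ P1 d) (hS : MeasurableSet S)
    (hzero : ∀ᵐ x ∂ρ, x - w ∉ S) {N : ℝ} (hN : 0 ≤ N) :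
    maxCorr (spread ρ S w) μ ≤ maxCorr ρ μ +
      ((‖w‖ * (N * ρ.real S + ∫ y, {y : Ed d | N < ‖y‖}.indicator norm y ∂μ) : ℝ) : EReal) := by
  have hψ := measurable_unspread (w := w) hS
  have hW : MeasurableSet ((· - w) ⁻¹' S) := measurable_sub_const w hS
  have hT : MeasurableSet {y : Ed d | N < ‖y‖} := measurableSet_lt measurable_const measurable_norm
  have hti : Integrable ({y : Ed d | N < ‖y‖}.indicator norm) μ := hμ.2.indicator hT
  have hσp : IsProbabilityMeasure (spread ρ S w) := isProbabilityMeasure_spread hS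
  refine iSup₂_le fun γ ⟨hγp, hγ1, hγ2⟩ => ?_
  set Φ : Ed d × Ed d → Ed d × Ed d := Prod.map (unspread S w) id with hΦ
  have hΦm : Measurable Φ := hψ.prodMap measurable_id
  have hγ' : γ.map Φ ∈ couplings ρ μ := by
    refine ⟨Measure.isProbabilityMeasure_map hΦm.aemeasurable, ?_, ?_⟩
    · rw [Measure.map_map measurable_fst hΦm]
      change γ.map (unspread S w ∘ Prod.fst) = ρ
      rw [← Measure.map_map hψ measurable_fst, hγ1, map_unspread_spread hS hzero]
    · rw [Measure.map_map measurable_snd hΦm]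
      exact hγ2
  set e₁ : Ed d → ℝ := ((· - w) ⁻¹' S).indicator fun _ => N with he₁
  set e₂ : Ed d → ℝ := {y : Ed d | N < ‖y‖}.indicator norm with he₂
  have hi₁ : Integrable e₁ (spread ρ S w) := (integrable_const N).indicator hW
  have hi₁' : Integrable (fun p : Ed d × Ed d => e₁ p.1) γ := by
    rw [← hγ1] at hi₁; exact hi₁.comp_measurable measurable_fst
  have hi₂' : Integrable (fun p : Ed d × Ed d => e₂ p.2) γ := by
    rw [← hγ2] at hti; exact hti.comp_measurable measurable_snd
  have hcost : sInt γ (fun p => ⟪p.1, p.2⟫) ≤ sInt γ (fun p => ⟪(Φ p).1, (Φ p).2⟫) +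
      ((∫ p, ‖w‖ * (e₁ p.1 + e₂ p.2) ∂γ : ℝ) : EReal) := by
    refine sInt_le_add (by fun_prop) (Measurable.aestronglyMeasurable (by fun_prop))
      ((hi₁'.add hi₂').const_mul _) fun p => ?_
    change |⟪p.1, p.2⟫ - ⟪unspread S w p.1, p.2⟫| ≤ _
    rw [← inner_sub_left]
    have hb₂ : 0 ≤ e₂ p.2 := Set.indicator_nonneg (fun _ _ => norm_nonneg _) _
    by_cases hp : p.1 - w ∈ S
    · have hy : ‖p.2‖ ≤ N + e₂ p.2 := by
        by_cases hy : N < ‖p.2‖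
        · have : e₂ p.2 = ‖p.2‖ := Set.indicator_of_mem (s := {y : Ed d | N < ‖y‖}) hy _
          linarith
        · linarith
      have h1 : e₁ p.1 = N := Set.indicator_of_mem (s := (· - w) ⁻¹' S) hp _
      have h2 : p.1 - unspread S w p.1 = w := by simp [unspread, hp]
      rw [h1, h2]
      exact (abs_real_inner_le_norm _ _).trans (by gcongr)
    · have h1 : e₁ p.1 = 0 := Set.indicator_of_notMem (s := (· - w) ⁻¹' S) hp _
      have h2 : p.1 - unspread S w p.1 = 0 := by simp [unspread, hp]
      rw [h1, h2, inner_zero_left, abs_zero]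
      positivity
  have hval : ∫ p, ‖w‖ * (e₁ p.1 + e₂ p.2) ∂γ ≤ ‖w‖ * (N * ρ.real S + ∫ y, e₂ y ∂μ) := by
    have h1 : ∫ p, e₁ p.1 ∂γ = N * (spread ρ S w).real ((· - w) ⁻¹' S) := by
      rw [← integral_map (φ := Prod.fst) (f := e₁) measurable_fst.aemeasurable
        (by rw [hγ1]; exact hi₁.aestronglyMeasurable), hγ1, he₁, integral_indicator_const _ hW,
        smul_eq_mul, mul_comm]
    have h2 : ∫ p, e₂ p.2 ∂γ = ∫ y, e₂ y ∂μ := by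
      rw [← integral_map (φ := Prod.snd) (f := e₂) measurable_snd.aemeasurable
        (by rw [hγ2]; exact hti.aestronglyMeasurable), hγ2]
    have h3 : (spread ρ S w).real ((· - w) ⁻¹' S) ≤ ρ.real S :=
      ENNReal.toReal_mono (measure_ne_top _ _) (spread_apply_translate_le hS hzero)
    rw [integral_const_mul, integral_add hi₁' hi₂', h1, h2]
    gcongr
  have hsup : sInt γ (fun p => ⟪(Φ p).1, (Φ p).2⟫) ≤ maxCorr ρ μ := by
    refine le_trans (le_of_eq ?_) (le_iSup₂ (f := fun γ _ => sInt γ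
      (fun p : Ed d × Ed d => ⟪p.1, p.2⟫)) (γ.map Φ) hγ')
    unfold sInt
    rw [lintegral_map (by fun_prop) hΦm, lintegral_map (by fun_prop) hΦm]
  exact hcost.trans (add_le_add hsup (EReal.coe_le_coe_iff.2 hval))

end Spread

/-- Comparison of a minimizer with the competitor `spread ρ S w`: the entropy gained by spreading
the mass of `S` is at most what is lost in the other two terms. -/
lemma IsMinOfF.mass_mul_log_two_le {d : ℕ} {α : ℝ} (hα : 0 < α) {μ ρ : Measure (Ed d)}
    (hμ : μ ∈ P1 d) (hmin : IsMinOfF α μ ρ) {g : Ed d → ℝ} (hg : Measurable g)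
    (hg0 : ∀ x, 0 ≤ g x) (hρ : ρ = volume.withDensity fun x => ENNReal.ofReal (g x))
    {S : Set (Ed d)} (hS : MeasurableSet S) {w : Ed d} {R N : ℝ} (hR : ∀ x ∈ S, ‖x‖ ≤ R)
    (hw : ‖w‖ ≤ 1) (hN : 0 ≤ N) (hzero : ∀ x ∈ S, g (x + w) = 0) :
    ρ.real S * Real.log 2 ≤
      ‖w‖ * (N * ρ.real S + ∫ y, {y : Ed d | N < ‖y‖}.indicator norm y ∂μ) +
        α / 2 * ((2 * R + 1) * ‖w‖ * ρ.real S) := by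
  obtain ⟨hlog, ⟨τ, hτ⟩, hM⟩ := hmin.terms_finite hα hμ hg hg0 hρ
  have hP : IsProbabilityMeasure ρ := hmin.1.1
  rcases S.eq_empty_or_nonempty with rfl | ⟨x₁, hx₁⟩
  · simp only [measureReal_empty, zero_mul, mul_zero, zero_add, add_zero]
    exact mul_nonneg (norm_nonneg _)
      (integral_nonneg fun y => Set.indicator_nonneg (fun _ _ => norm_nonneg _) _)
  have hR0 : 0 ≤ R := (norm_nonneg x₁).trans (hR x₁ hx₁)
  have hgint : Integrable g volume := by
    rw [← lintegral_ofReal_ne_top_iff_integrable (by fun_prop) (.of_forall hg0)]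
    have : ρ Set.univ = ∫⁻ x, ENNReal.ofReal (g x) := by
      rw [hρ, withDensity_apply _ MeasurableSet.univ, Measure.restrict_univ]
    rw [← this]
    exact measure_ne_top _ _
  have hmass : ∫ x in S, g x = ρ.real S := by
    rw [integral_eq_lintegral_of_nonneg_ae (.of_forall hg0) (by fun_prop), measureReal_def, hρ,
      withDensity_apply _ hS]
  have hzero' : ∀ᵐ x ∂ρ, x - w ∉ S := by
    rw [hρ, ae_withDensity_iff hg.ennreal_ofReal]
    refine .of_forall fun x hx hxS => hx ?_
    have := hzero _ hxS
    rw [sub_add_cancel] at this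
    rw [this, ENNReal.ofReal_zero]
  have hE := Ent_spread hg hg0 hρ hS hgint hlog hzero
  have hEρ : Ent ρ = ((∫ x, g x * Real.log (g x) : ℝ) : EReal) := by
    rw [← sInt_eq_integral hlog, ← Ent_withDensity hg hg0, hρ]
  have hTσ := maxCorr_spread_le (ρ := ρ) (w := w) hμ hS hzero' hN
  have hMσ := M2e_spread_le (ρ := ρ) hS hR hw
  have hle := hmin.2 _ (spread_mem_P1 (w := w) hmin.1 hS)
  set T : ℝ := ∫ y, {y : Ed d | N < ‖y‖}.indicator norm y ∂μ
  set η : ℝ := ∫ x, g x * Real.log (g x)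
  have hMσ' : ((M2e (spread ρ S w) : ℝ≥0∞) : EReal) ≤
      (((M2e ρ).toReal + (2 * R + 1) * ‖w‖ * ρ.real S : ℝ) : EReal) := by
    rw [EReal.coe_add, EReal.coe_mul, EReal.coe_ennreal_toReal hM, measureReal_def,
      EReal.coe_ennreal_toReal (measure_ne_top _ _)]
    refine (EReal.coe_ennreal_le_coe_ennreal_iff.2 hMσ).trans (le_of_eq ?_)
    rw [EReal.coe_ennreal_add, EReal.coe_ennreal_mul, EReal.coe_ennreal_ofReal,
      max_eq_left (by positivity)]
  have hα2 : (0 : EReal) ≤ ((α / 2 : ℝ) : EReal) := EReal.coe_nonneg.2 (by positivity)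
  have hfinal : ((η + τ + α / 2 * (M2e ρ).toReal : ℝ) : EReal) ≤
      ((η - Real.log 2 * ρ.real S + (τ + ‖w‖ * (N * ρ.real S + T)) +
        α / 2 * ((M2e ρ).toReal + (2 * R + 1) * ‖w‖ * ρ.real S) : ℝ) : EReal) := by
    calc _ = Ffun α μ ρ := by
          unfold Ffun
          rw [hEρ, hτ, EReal.coe_add, EReal.coe_add, EReal.coe_mul (α / 2),
            EReal.coe_ennreal_toReal hM]
      _ ≤ Ffun α μ (spread ρ S w) := hle
      _ ≤ _ := by
          unfold Ffun
          rw [hE, hmass, EReal.coe_add, EReal.coe_add (η - _), EReal.coe_add τ,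
            EReal.coe_mul (α / 2), ← hτ]
          exact add_le_add (add_le_add le_rfl hTσ) (mul_le_mul_of_nonneg_left hMσ' hα2)
  have := EReal.coe_le_coe_iff.1 hfinal
  linarith

lemma exists_tail_le {d : ℕ} {μ : Measure (Ed d)} (hμ : μ ∈ P1 d) {ε : ℝ} (hε : 0 < ε) :
    ∃ N : ℝ, 0 ≤ N ∧ ∫ y, {y : Ed d | N < ‖y‖}.indicator norm y ∂μ ≤ ε := by
  have hlim : Tendsto (fun n : ℕ => ∫ y, {y : Ed d | (n : ℝ) < ‖y‖}.indicator norm y ∂μ) atTop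
      (𝓝 (∫ _, (0 : ℝ) ∂μ)) := by
    refine tendsto_integral_of_dominated_convergence (fun y => ‖y‖) (fun n => ?_) hμ.2
      (fun n => .of_forall fun y => ?_) (.of_forall fun y => ?_)
    · exact (measurable_norm.indicator
        (measurableSet_lt measurable_const measurable_norm)).aestronglyMeasurable
    · simpa using norm_indicator_le_norm_self (s := {y : Ed d | (n : ℝ) < ‖y‖}) norm y
    · refine tendsto_const_nhds.congr' ?_
      filter_upwards [eventually_ge_atTop ⌈‖y‖⌉₊] with n hn
      exact (Set.indicator_of_notMem (s := {y : Ed d | (n : ℝ) < ‖y‖})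
        (not_lt.2 (Nat.ceil_le.1 hn)) _).symm
  rw [integral_zero] at hlim
  obtain ⟨n, hn⟩ := (hlim.eventually (eventually_le_nhds hε)).exists
  exact ⟨n, n.cast_nonneg, hn⟩

lemma eventually_mul_le {K b : ℝ} (hb : 0 < b) : ∀ᶠ s in 𝓝[>] (0 : ℝ), s * K ≤ b := by
  have h : Tendsto (fun s : ℝ => s * K) (𝓝[>] 0) (𝓝 0) := by
    have : Tendsto (fun s : ℝ => s * K) (𝓝 0) (𝓝 (0 * K)) :=
      (continuous_id.mul continuous_const).tendsto 0
    rw [zero_mul] at this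
    exact this.mono_left nhdsWithin_le_nhds
  exact h.eventually (eventually_le_nhds hb)

/-- The density `Z⁻¹ exp (-u - (α/2)‖·‖²)` as a real-valued function. -/
def realDens {d : ℕ} (α Z : ℝ) (u : Ed d → EReal) (x : Ed d) : ℝ := by
  classical
  exact if u x = ⊤ then 0 else 1 / Z * Real.exp (-(u x).toReal - (α / 2) * ‖x‖ ^ 2)

section Density

variable {d : ℕ} {α Z : ℝ} {u : Ed d → EReal}

lemma realDens_nonneg (hZ : 0 < Z) (x : Ed d) : 0 ≤ realDens α Z u x := by
  unfold realDens
  split_ifs <;> positivity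

lemma realDens_eq_zero {x : Ed d} (hx : u x = ⊤) : realDens α Z u x = 0 := if_pos hx

lemma measurable_realDens (hu : Measurable u) : Measurable (realDens α Z u) := by
  refine Measurable.ite (hu (measurableSet_singleton ⊤)) measurable_const ?_
  have := hu.ereal_toReal
  fun_prop

lemma ofReal_realDens (hZ : 0 < Z) (x : Ed d) :
    ENNReal.ofReal (1 / Z) * gdens α u x = ENNReal.ofReal (realDens α Z u x) := by
  unfold realDens gdens
  split_ifs
  · simp
  · rw [ENNReal.ofReal_mul (by positivity)]

lemma le_realDens (hα : 0 < α) (hZ : 0 < Z) {x : Ed d} {M R : ℝ} (hbot : u x ≠ ⊥)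
    (hM : u x ≤ (M : EReal)) (hR : ‖x‖ ≤ R) :
    1 / Z * Real.exp (-M - (α / 2) * R ^ 2) ≤ realDens α Z u x := by
  have htop : u x ≠ ⊤ := ne_top_of_le_ne_top (EReal.coe_ne_top _) hM
  have hM' : (u x).toReal ≤ M := by
    rw [← EReal.coe_toReal htop hbot] at hM
    exact EReal.coe_le_coe_iff.1 hM
  unfold realDens
  rw [if_neg htop]
  gcongr

end Density

/-- A bounded piece of the boundary on which the potential is bounded above is negligible. -/
lemma hausdorffMeasure_frontier_piece_eq_zero {d : ℕ} (hd : 1 ≤ d) {α : ℝ} (hα : 0 < α)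
    {μ ρ : Measure (Ed d)} (hμ : μ ∈ P1 d) (hmin : IsMinOfF α μ ρ) {u : Ed d → EReal} {Z : ℝ}
    (hZ : 0 < Z) (hconv : EConvexOn u) (hmeas : Measurable u) (hbot : ∀ x, u x ≠ ⊥)
    (hrep : ρ = volume.withDensity fun x => ENNReal.ofReal (realDens α Z u x))
    {x₀ a₀ : Ed d} {r M : ℝ} (hr : 0 < r) (hball : Metric.ball x₀ r ⊆ {x | u x ≤ (M : EReal)}) :
    μH[(d : ℝ) - 1] {a | a ∈ frontier {y | u y < ⊤} ∧ u a ≤ (M : EReal) ∧ ‖a - a₀‖ < r / 2} =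
      0 := by
  set A : Set (Ed d) := {a | a ∈ frontier {y | u y < ⊤} ∧ u a ≤ (M : EReal) ∧ ‖a - a₀‖ < r / 2}
  have hP : IsProbabilityMeasure ρ := hmin.1.1
  set v : Ed d := a₀ - x₀ with hv
  set D : ℝ := ‖v‖ + 2 * r with hDdef
  have hD0 : 0 < D := by positivity
  have hD : ∀ a ∈ A, ‖x₀ - a‖ + r ≤ D := by
    intro a ha
    have h1 : ‖x₀ - a‖ ≤ ‖v‖ + ‖a - a₀‖ := by
      rw [norm_sub_rev x₀ a, hv, add_comm]
      exact norm_sub_le_norm_sub_add_norm_sub a a₀ x₀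
    linarith [ha.2.2]
  refine hausdorffMeasure_eq_zero_of_volume_coneNbhd hd A x₀ hr hD hD0 fun c hc => ?_
  set R : ℝ := ‖a₀‖ + r + D with hRdef
  have hR0 : 0 < R := by positivity
  set δ : ℝ := 1 / Z * Real.exp (-M - (α / 2) * R ^ 2) with hδ
  have hδ0 : 0 < δ := by positivity
  set κ : ℝ := 2 * D * ‖v‖ / r with hκ
  have hκ0 : 0 ≤ κ := by positivity
  obtain ⟨N, hN, htail⟩ := exists_tail_le hμ (ε := c * δ / (4 * (κ + 1))) (by positivity)
  set T : ℝ := ∫ y, {y : Ed d | N < ‖y‖}.indicator norm y ∂μ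
  have hT0 : 0 ≤ T := integral_nonneg fun y => Set.indicator_nonneg (fun _ _ => norm_nonneg _) _
  have hκT : 4 * (κ * T) ≤ c * δ := by
    rw [le_div_iff₀ (by positivity)] at htail
    nlinarith
  filter_upwards [eventually_mul_le (K := 1) one_pos, eventually_mul_le (K := κ) one_pos,
    eventually_mul_le (K := κ * (N + α / 2 * (2 * R + 1))) (b := 1 / 4) (by norm_num),
    self_mem_nhdsWithin] with s hs1 hs2 hs3 hs0
  rw [Set.mem_Ioi] at hs0
  rw [mul_one] at hs1
  set S : Set (Ed d) := coneNbhd A x₀ r s with hSdef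
  have hSm : MeasurableSet S := (isOpen_coneNbhd A x₀ r s).measurableSet
  have hnear : ∀ x ∈ S, ∃ a ∈ A, ‖x - a‖ < s * D := by
    intro x hx
    obtain ⟨a, ha, hxa⟩ := Set.mem_iUnion₂.1 hx
    exact ⟨a, ha, dist_lt_of_mem_contracted_ball hs0 (hD a ha) hxa⟩
  have hSR : ∀ x ∈ S, ‖x‖ ≤ R := by
    intro x hx
    obtain ⟨a, ha, hxa⟩ := hnear x hx
    have h1 : ‖x‖ ≤ ‖x - a‖ + ‖a - a₀‖ + ‖a₀‖ := by
      calc ‖x‖ = ‖(x - a) + (a - a₀) + a₀‖ := by congr 1; abel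
        _ ≤ _ := norm_add₃_le
    have h2 : s * D ≤ D := by nlinarith
    linarith [ha.2.2]
  have hSM : S ⊆ {x | u x ≤ (M : EReal)} :=
    coneNbhd_subset (hconv.convex_sublevel M) (fun a ha => ha.2.1) hball hs0 hs1
  set w : Ed d := (2 * (s * D) / r) • v with hw
  have hwn : ‖w‖ = s * κ := by
    rw [hw, norm_smul, Real.norm_of_nonneg (by positivity), hκ]
    ring
  have hzero : ∀ x ∈ S, realDens α Z u (x + w) = 0 := by
    intro x hx
    obtain ⟨a, ha, hxa⟩ := hnear x hx
    refine realDens_eq_zero (not_lt_top_iff.1 ?_)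
    exact add_smul_notMem_of_mem_frontier hconv.convex_domain (by positivity) hr
      (hball.trans fun x hx => lt_of_le_of_lt hx (EReal.coe_lt_top M)) ha.1 ha.2.2 hxa
  have hkey := hmin.mass_mul_log_two_le hα hμ (measurable_realDens hmeas)
    (fun x => realDens_nonneg hZ x) hrep hSm hSR (hwn ▸ hs2) hN hzero
  have hm0 : 0 ≤ ρ.real S := measureReal_nonneg
  have hmass : ρ.real S ≤ δ * (c * s) := by
    rw [hwn] at hkey
    have hlog := Real.log_two_gt_d9
    have h1 : ρ.real S * (s * (κ * (N + α / 2 * (2 * R + 1)))) ≤ ρ.real S * (1 / 4) := by gcongr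
    have h2 : s * (4 * (κ * T)) ≤ s * (c * δ) := by gcongr
    have h3 : ρ.real S * (1 / 2) ≤ ρ.real S * Real.log 2 := by gcongr; linarith
    linarith
  have hlow : ENNReal.ofReal δ * volume S ≤ ρ S := by
    rw [hrep, withDensity_apply _ hSm, ← setLIntegral_const]
    exact setLIntegral_mono' hSm fun x hx => ENNReal.ofReal_le_ofReal
      (le_realDens hα hZ (hbot x) (hSM hx) (hSR x hx))
  have hδe : ENNReal.ofReal δ ≠ 0 := by simpa using hδ0
  rw [← ENNReal.mul_le_mul_iff_right hδe ENNReal.ofReal_ne_top, ← ENNReal.ofReal_mul hδ0.le]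
  calc _ ≤ ρ S := hlow
    _ = ENNReal.ofReal (ρ.real S) := (ENNReal.ofReal_toReal (measure_ne_top _ _)).symm
    _ ≤ _ := ENNReal.ofReal_le_ofReal hmass

lemma LowerSemicontinuous.continuousAt_of_eq_top {d : ℕ} {u : Ed d → EReal}
    (hu : LowerSemicontinuous u) {x : Ed d} (hx : u x = ⊤) : ContinuousAt u x := by
  rw [ContinuousAt, hx, EReal.tendsto_nhds_top_iff_real]
  exact fun y => hu x y (by simp [hx])

lemma hausdorffMeasure_frontier_ne_top_eq_zero {d : ℕ} (hd : 1 ≤ d) {α : ℝ} (hα : 0 < α)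
    {μ ρ : Measure (Ed d)} (hμ : μ ∈ P1 d) (hmin : IsMinOfF α μ ρ) {u : Ed d → EReal} {Z : ℝ}
    (hZ : 0 < Z) (hconv : EConvexOn u) (hmeas : Measurable u)
    (hrep : ρ = volume.withDensity fun x => ENNReal.ofReal (realDens α Z u x)) :
    μH[(d : ℝ) - 1] {x ∈ frontier {y : Ed d | u y < ⊤} | u x ≠ ⊤} = 0 := by
  by_cases hbot : ∀ x, u x ≠ ⊥
  · have hvol : volume {x | u x < ⊤} ≠ 0 := by
      intro h0
      have hP : IsProbabilityMeasure ρ := hmin.1.1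
      refine IsProbabilityMeasure.ne_zero ρ (hrep.trans ?_)
      rw [← withDensity_zero]
      refine withDensity_congr_ae ?_
      filter_upwards [measure_eq_zero_iff_ae_notMem.1 h0] with x hx
      rw [realDens_eq_zero (not_lt_top_iff.1 hx), ENNReal.ofReal_zero, Pi.zero_apply]
    obtain ⟨n, x₀, r, hr, hball⟩ := exists_ball_subset_sublevel hconv hvol
    refine measure_null_of_locally_null _ fun a₀ _ => ?_
    refine ⟨_ ∩ Metric.ball a₀ (r / 2), inter_mem_nhdsWithin _
      (Metric.ball_mem_nhds _ (by positivity)), ?_⟩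
    refine measure_mono_null (t := ⋃ m : ℕ, {a | a ∈ frontier {y | u y < ⊤} ∧
      u a ≤ ((max n m : ℝ) : EReal) ∧ ‖a - a₀‖ < r / 2}) ?_ (measure_iUnion_null fun m => ?_)
    · rintro a ⟨⟨haf, hat⟩, hab⟩
      obtain ⟨m, hm⟩ := EReal.exists_nat_ge_of_lt_top (lt_top_iff_ne_top.2 hat)
      exact Set.mem_iUnion.2 ⟨m, haf, hm.trans (EReal.coe_le_coe_iff.2 (le_max_right _ _)),
        mem_ball_iff_norm.1 hab⟩
    · exact hausdorffMeasure_frontier_piece_eq_zero hd hα hμ hmin hZ hconv hmeas hbot hrep hr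
        fun x hx => (hball hx).trans (EReal.coe_le_coe_iff.2 (le_max_left _ _))
  · push Not at hbot
    obtain ⟨x, hx⟩ := hbot
    have huniv : {y : Ed d | u y < ⊤} = Set.univ := by
      ext y
      simp [hconv.eq_bot hx y]
    simp [huniv]

/-- the potential `u` of the minimizer equals `+∞` at `H^{d-1}`-almost
every point of the boundary of its finiteness domain; in particular it is essentially
continuous. -/
theorem stmt4 (d : ℕ) (hd : 1 ≤ d) (α : ℝ) (hα : 0 < α)
    (μ : Measure (Ed d)) (hμ : μ ∈ P1 d)
    (ρ : Measure (Ed d)) (hmin : IsMinOfF α μ ρ)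
    (u : Ed d → EReal) (Z : ℝ) (hZ : 0 < Z)
    (hconv : EConvexOn u) (hlsc : LowerSemicontinuous u)
    (hrep : ρ = (volume : Measure (Ed d)).withDensity
      (fun x => ENNReal.ofReal (1 / Z) * gdens α u x))
    (hT : maxCorr ρ μ = eInt ρ u + eInt μ (legendre u)) :
    μH[(d : ℝ) - 1] {x ∈ frontier {y : Ed d | u y < ⊤} | u x ≠ ⊤} = 0 ∧
      EssentiallyContinuous u := by
  have hnull := hausdorffMeasure_frontier_ne_top_eq_zero hd hα hμ hmin hZ hconv hlsc.measurable
    (hrep.trans (by simp_rw [ofReal_realDens hZ]))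
  refine ⟨hnull, ?_⟩
  unfold EssentiallyContinuous
  refine measure_mono_null ?_ hnull
  rintro x ⟨hx, hc⟩
  exact ⟨hx, fun h => hc (hlsc.continuousAt_of_eq_top h)⟩
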